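/- arXiv:2305.04431 — 2 statements merged into one kernel-verified Lean document; each statement's English description precedes it below -/
import Mathlib

section
/- The matrix exponential maps the skew-symmetric 3×3 real matrices onto SO(3): for every 3×3 real matrix R with Rᵀ·R = 1 and det R = 1, there exists a 3×3 real matrix A with Aᵀ = −A such that exp(A) = R. -/
open Matrix

theorem rodrigues_gen_aux {M : Type*} [NormedRing M] [NormedAlgebra ℝ M] [CompleteSpace M]
    (K : M) (hK : K * (K * K) = -K) (t : ℝ) :
    NormedSpace.exp (t • K) = 1 + Real.sin t • K + (1 - Real.cos t) • (K * K) := by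
  letI : NormedAlgebra ℚ M := NormedAlgebra.restrictScalars ℚ ℝ M
  have key : ∀ s : ℝ, HasDerivAt (fun s : ℝ => NormedSpace.exp (s • (-K)) *
      (1 + Real.sin s • K + (1 - Real.cos s) • (K * K))) 0 s := by
    intro s
    have h1 := hasDerivAt_exp_smul_const (𝕂 := ℝ) (-K) s
    have h2 : HasDerivAt (fun s : ℝ => (1 + Real.sin s • K + (1 - Real.cos s) • (K * K)))
        (Real.cos s • K + Real.sin s • (K * K)) s := by
      have a := (Real.hasDerivAt_sin s).smul_const K
      have b := ((Real.hasDerivAt_cos s).const_sub 1).smul_const (K * K)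
      have := (a.const_add 1).add b
      rw [neg_neg] at this
      exact this
    have h3 := h1.mul h2
    have h4 : NormedSpace.exp (s • -K) * -K *
        (1 + Real.sin s • K + (1 - Real.cos s) • (K * K)) +
        NormedSpace.exp (s • -K) * (Real.cos s • K + Real.sin s • (K * K)) = 0 := by
      rw [mul_assoc, ← mul_add]
      have : -K * (1 + Real.sin s • K + (1 - Real.cos s) • (K * K)) +
        (Real.cos s • K + Real.sin s • (K * K)) = 0 := by
        simp only [neg_mul, mul_add, mul_one, mul_smul_comm, hK]
        module
      rw [this, mul_zero]
    rw [h4] at h3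
    exact h3
  have hc := is_const_of_deriv_eq_zero (fun s => (key s).differentiableAt)
    (fun s => (key s).deriv) t 0
  simp only [zero_smul, Real.sin_zero, Real.cos_zero, sub_self, add_zero, mul_one,
    NormedSpace.exp_zero] at hc
  have hi : NormedSpace.exp (t • K) * NormedSpace.exp (t • (-K)) = 1 := by
    rw [← NormedSpace.exp_add_of_commute]
    · simp
    · simp [Commute, SemiconjBy]
  calc NormedSpace.exp (t • K) = NormedSpace.exp (t • K) * (NormedSpace.exp (t • (-K)) *
      (1 + Real.sin t • K + (1 - Real.cos t) • (K * K))) := by rw [hc, mul_one]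
    _ = _ := by rw [← mul_assoc, hi, one_mul]

section RodriguesAux
attribute [local instance] Matrix.linftyOpNormedRing Matrix.linftyOpNormedAlgebra

theorem rodrigues_aux (K : Matrix (Fin 3) (Fin 3) ℝ) (hK : K * (K * K) = -K) (t : ℝ) :
    NormedSpace.exp (t • K) = 1 + Real.sin t • K + (1 - Real.cos t) • (K * K) :=
  rodrigues_gen_aux K hK t

end RodriguesAux

theorem exists_unit_fixed_aux (R : Matrix (Fin 3) (Fin 3) ℝ)
    (hR : Rᵀ * R = 1) (hdet : R.det = 1) :
    ∃ u : Fin 3 → ℝ, R *ᵥ u = u ∧ u 0 ^ 2 + u 1 ^ 2 + u 2 ^ 2 = 1 := by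
  have h0 : (R - 1).det = 0 := by
    have h1 : Rᵀ * (R - 1) = -(R - 1)ᵀ := by
      rw [mul_sub, hR]; simp
    have h2 := congrArg Matrix.det h1
    rw [Matrix.det_mul, Matrix.det_neg, Matrix.det_transpose, Matrix.det_transpose, hdet] at h2
    simp only [Fintype.card_fin] at h2
    linarith
  obtain ⟨v, hv, hv2⟩ := Matrix.exists_mulVec_eq_zero_iff.mpr h0
  rw [Matrix.sub_mulVec, Matrix.one_mulVec, sub_eq_zero] at hv2
  have hpos : 0 < v 0 ^ 2 + v 1 ^ 2 + v 2 ^ 2 := by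
    by_contra hn
    apply hv
    have a := sq_nonneg (v 0)
    have b := sq_nonneg (v 1)
    have c := sq_nonneg (v 2)
    funext i
    fin_cases i
    · exact pow_eq_zero_iff two_ne_zero |>.mp (by linarith : v 0 ^ 2 = 0)
    · exact pow_eq_zero_iff two_ne_zero |>.mp (by linarith : v 1 ^ 2 = 0)
    · exact pow_eq_zero_iff two_ne_zero |>.mp (by linarith : v 2 ^ 2 = 0)
  refine ⟨(Real.sqrt (v 0 ^ 2 + v 1 ^ 2 + v 2 ^ 2))⁻¹ • v, ?_, ?_⟩
  · rw [Matrix.mulVec_smul, hv2]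
  · simp only [Pi.smul_apply, smul_eq_mul, mul_pow, ← mul_add]
    rw [inv_pow, Real.sq_sqrt hpos.le]
    exact inv_mul_cancel₀ hpos.ne'

theorem exists_frame_aux (u : Fin 3 → ℝ) (hu : u 0 ^ 2 + u 1 ^ 2 + u 2 ^ 2 = 1) :
    ∃ P : Matrix (Fin 3) (Fin 3) ℝ, Pᵀ * P = 1 ∧ P *ᵥ ![1, 0, 0] = u := by
  obtain ⟨a, ha⟩ : ∃ a, a = u 0 := ⟨_, rfl⟩
  obtain ⟨b, hb⟩ : ∃ b, b = u 1 := ⟨_, rfl⟩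
  obtain ⟨c, hc⟩ : ∃ c, c = u 2 := ⟨_, rfl⟩
  rw [← ha, ← hb, ← hc] at hu
  obtain ⟨k, hkb, hkc⟩ : ∃ k : ℝ, b * (k * (1 - a)) = b ∧ c * (k * (1 - a)) = c := by
    by_cases h : a = 1
    · subst h
      refine ⟨0, ?_, ?_⟩ <;> nlinarith [sq_nonneg b, sq_nonneg c]
    · have : 1 - a ≠ 0 := fun h' => h (by linarith)
      exact ⟨(1 - a)⁻¹, by simp [this], by simp [this]⟩
  refine ⟨!![a, b, c; b, 1 - k * b ^ 2, - k * b * c; c, - k * b * c, 1 - k * c ^ 2], ?_, ?_⟩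
  · ext i j
    fin_cases i <;> fin_cases j <;>
      simp [Matrix.mul_apply, Fin.sum_univ_three]
    all_goals grind
  · funext i
    fin_cases i <;> simp [Matrix.mulVec, dotProduct, Fin.sum_univ_three, ha, hb, hc]

theorem block_aux (Q : Matrix (Fin 3) (Fin 3) ℝ) (hQ : Qᵀ * Q = 1) (hdet : Q.det = 1)
    (he : Q *ᵥ ![1, 0, 0] = ![1, 0, 0]) :
    ∃ A : Matrix (Fin 3) (Fin 3) ℝ, Aᵀ = -A ∧ NormedSpace.exp A = Q := by
  have e0 := congrFun he 0
  have e1 := congrFun he 1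
  have e2 := congrFun he 2
  simp [Matrix.mulVec, dotProduct, Fin.sum_univ_three] at e0 e1 e2
  have q := fun i j => congrFun (congrFun hQ i) j
  simp only [Matrix.mul_apply, Fin.sum_univ_three, Matrix.transpose_apply] at q
  have q01 := q 0 1
  have q02 := q 0 2
  have q11 := q 1 1
  have q12 := q 1 2
  have q22 := q 2 2
  simp [e0, e1, e2] at q01 q02 q11 q12 q22
  rw [Matrix.det_fin_three] at hdet
  simp [e0, e1, e2, q01, q02] at hdet q11 q12 q22
  have h1 : Q 2 2 = Q 1 1 := by grind
  have h2 : Q 1 2 = - Q 2 1 := by grind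
  obtain ⟨t, hc, hs⟩ : ∃ t : ℝ, Real.cos t = Q 1 1 ∧ Real.sin t = Q 2 1 := by
    have hn : ‖(⟨Q 1 1, Q 2 1⟩ : ℂ)‖ = 1 := by
      rw [Complex.norm_def, Complex.normSq_mk, q11, Real.sqrt_one]
    have hne : (⟨Q 1 1, Q 2 1⟩ : ℂ) ≠ 0 := by
      intro h; rw [h] at hn; simp at hn
    refine ⟨Complex.arg ⟨Q 1 1, Q 2 1⟩, ?_, ?_⟩
    · rw [Complex.cos_arg hne, hn, div_one]
    · rw [Complex.sin_arg, hn, div_one]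
  refine ⟨t • !![0, 0, 0; 0, 0, -1; 0, 1, 0], ?_, ?_⟩
  · ext i j
    fin_cases i <;> fin_cases j <;> simp
  · rw [rodrigues_aux]
    · ext i j
      fin_cases i <;> fin_cases j <;>
        simp [Matrix.mul_apply, Fin.sum_univ_three, e0, e1, e2, q01, q02, hc, hs, h1, h2]
    · ext i j
      fin_cases i <;> fin_cases j <;> simp [Matrix.mul_apply, Fin.sum_univ_three]

/-- The matrix exponential maps the skew-symmetric `3×3` real matrices onto `SO(3)`:
every `R` with `Rᵀ · R = 1` and `det R = 1` is `exp(A)` for some `A` with `Aᵀ = -A`. -/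
theorem exp_skewSymmetric_surjective_SO3 (R : Matrix (Fin 3) (Fin 3) ℝ)
    (hR : Rᵀ * R = 1) (hdet : R.det = 1) :
    ∃ A : Matrix (Fin 3) (Fin 3) ℝ, Aᵀ = -A ∧ NormedSpace.exp A = R := by
  obtain ⟨u, hu, hn⟩ := exists_unit_fixed_aux R hR hdet
  obtain ⟨P, hP, hPu⟩ := exists_frame_aux u hn
  have hP' : P * Pᵀ = 1 := mul_eq_one_comm.mp hP
  have hinv : P⁻¹ = Pᵀ := Matrix.inv_eq_left_inv hP
  obtain ⟨A, hA, hAe⟩ := block_aux (Pᵀ * R * P) (by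
      calc (Pᵀ * R * P)ᵀ * (Pᵀ * R * P) = Pᵀ * (Rᵀ * ((P * Pᵀ) * R)) * P := by
            simp only [Matrix.transpose_mul, Matrix.transpose_transpose, mul_assoc]
        _ = 1 := by rw [hP', one_mul, hR, mul_one, hP])
    (by
      have := congrArg Matrix.det hP
      rw [Matrix.det_mul, Matrix.det_one] at this
      rw [Matrix.det_mul, Matrix.det_mul, hdet, mul_one, this])
    (by
      rw [← Matrix.mulVec_mulVec, hPu, ← Matrix.mulVec_mulVec, hu, ← hPu, Matrix.mulVec_mulVec,
        hP, Matrix.one_mulVec])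
  refine ⟨P * A * P⁻¹, ?_, ?_⟩
  · rw [hinv]
    simp only [Matrix.transpose_mul, Matrix.transpose_transpose, hA]
    simp [mul_assoc]
  · rw [Matrix.exp_conj P A (IsUnit.of_mul_eq_one _ hP'), hAe, hinv]
    calc P * (Pᵀ * R * P) * Pᵀ = (P * Pᵀ) * R * (P * Pᵀ) := by simp only [mul_assoc]
      _ = R := by rw [hP', one_mul, mul_one]
end

section
/- Let G be a subgroup of the group GL(n, ℝ) of invertible n×n real matrices that is closed in GL(n, ℝ) and connected (a connected matrix Lie group), and let 𝔤 := { X : n×n real matrix | exp(t·X) ∈ G for all t ∈ ℝ } be its Lie algebra. Then every element g ∈ G can be written as a finite product of exponentials of elements of the Lie algebra: there exist M ∈ ℕ and X₁, …, X_M ∈ 𝔤 such that g = exp(X₁)·exp(X₂)⋯exp(X_M). -/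
open scoped MatrixGroups

namespace CartanAux

open Filter Topology NormedSpace

section
variable {A : Type*} [NormedRing A] [NormedAlgebra ℝ A] [CompleteSpace A]

theorem exp_add_comm {x y : A} (h : Commute x y) : exp (x + y) = exp x * exp y := by
  let _ : NormedAlgebra ℚ A := NormedAlgebra.restrictScalars ℚ ℝ A
  exact exp_add_of_commute h

theorem exp_cont : Continuous (exp : A → A) := by
  let _ : NormedAlgebra ℚ A := NormedAlgebra.restrictScalars ℚ ℝ A
  exact exp_continuous

/-- The exponential as a unit. -/
noncomputable def expU (x : A) : Aˣ where
  val := exp x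
  inv := exp (-x)
  val_inv := by
    rw [← exp_add_comm (Commute.refl x).neg_right]; simp
  inv_val := by
    rw [← exp_add_comm (Commute.refl x).neg_left]; simp

theorem expU_val (x : A) : (expU x : A) = exp x := rfl

theorem expU_neg (x : A) : expU (-x) = (expU x)⁻¹ := by
  ext; simp only [expU]; rfl

theorem expU_zero : expU (0 : A) = 1 := by
  ext; simp [expU]

theorem expU_nsmul (m : ℕ) (x : A) : expU (m • x) = expU x ^ m := by
  ext
  let _ : NormedAlgebra ℚ A := NormedAlgebra.restrictScalars ℚ ℝ A
  rw [Units.val_pow_eq_pow_val, expU_val, expU_val, exp_nsmul]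

theorem expU_zsmul (m : ℤ) (x : A) : expU (m • x) = expU x ^ m := by
  cases m with
  | ofNat m => rw [Int.ofNat_eq_natCast, natCast_zsmul, zpow_natCast, expU_nsmul]
  | negSucc m => rw [negSucc_zsmul, expU_neg, expU_nsmul, zpow_negSucc]

theorem expU_cont : Continuous (expU : A → Aˣ) := by
  rw [Units.isOpenEmbedding_val.isEmbedding.continuous_iff]
  exact exp_cont

theorem lim_mem (G : Subgroup Aˣ) (hG : IsClosed (G : Set Aˣ)) (c : ℕ → ℝ) (x : ℕ → A) (X : A)
    (hx : Tendsto x atTop (𝓝 0)) (hxG : ∀ᶠ k in atTop, expU (x k) ∈ G)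
    (hc : Tendsto (fun k => c k • x k) atTop (𝓝 X)) (t : ℝ) : expU (t • X) ∈ G := by
  have h1 : Tendsto (fun k => ⌊t * c k⌋ • x k) atTop (𝓝 (t • X)) := by
    have h2 : Tendsto (fun k => Int.fract (t * c k) • x k) atTop (𝓝 0) := by
      apply squeeze_zero_norm (a := fun k => ‖x k‖)
      · intro k
        rw [norm_smul]
        have h0 := Int.fract_nonneg (t * c k)
        have h3 := (Int.fract_lt_one (t * c k)).le
        rw [Real.norm_of_nonneg h0]
        exact mul_le_of_le_one_left (norm_nonneg _) h3
      · simpa using hx.norm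
    have h3 := (hc.const_smul t).sub h2
    rw [sub_zero] at h3
    refine h3.congr fun k => ?_
    rw [smul_smul, ← sub_smul, Int.self_sub_fract, Int.cast_smul_eq_zsmul]
  have h4 := (expU_cont.tendsto (t • X)).comp h1
  refine hG.mem_of_tendsto h4 ?_
  filter_upwards [hxG] with k hk
  simp only [Function.comp, expU_zsmul]
  exact G.zpow_mem hk _

theorem strict_exp : HasStrictFDerivAt (exp : A → A)
    ((ContinuousLinearEquiv.refl ℝ A : A ≃L[ℝ] A) : A →L[ℝ] A) 0 :=
  hasStrictFDerivAt_exp_zero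

theorem add_mem_aux (G : Subgroup Aˣ) (hG : IsClosed (G : Set Aˣ)) (X Y : A)
    (hX : ∀ t : ℝ, expU (t • X) ∈ G) (hY : ∀ t : ℝ, expU (t • Y) ∈ G) (t : ℝ) :
    expU (t • (X + Y)) ∈ G := by
  set f : ℝ → A := fun s => exp (s • X) * exp (s • Y) with hf
  have hf0 : f 0 = 1 := by simp [hf]
  set L := (strict_exp (A := A)).localInverse with hL
  have hL1 : L 1 = 0 := by
    have := (strict_exp (A := A)).localInverse_apply_image
    rwa [exp_zero] at this
  have hLd : HasFDerivAt L (ContinuousLinearMap.id ℝ A) 1 := by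
    have := (strict_exp (A := A)).to_localInverse.hasFDerivAt
    rwa [exp_zero] at this
  have hd (Z : A) : HasDerivAt (fun s : ℝ => exp (s • Z)) Z 0 := by
    have h1 : HasFDerivAt (exp : A → A) (ContinuousLinearMap.id ℝ A) ((0:ℝ) • Z) := by
      rw [zero_smul]; exact hasFDerivAt_exp_zero
    have h2 : HasDerivAt (fun s : ℝ => s • Z) Z 0 := by
      simpa using (hasDerivAt_id (0:ℝ)).smul_const Z
    exact h1.comp_hasDerivAt (0:ℝ) h2
  have hfd : HasDerivAt f (X + Y) 0 := by
    have h := (hd X).mul (hd Y)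
    simp only [zero_smul, exp_zero, mul_one, one_mul] at h
    exact h
  have hgd : HasDerivAt (fun s => L (f s)) (X + Y) 0 := by
    rw [← hf0] at hLd
    exact hLd.comp_hasDerivAt (0:ℝ) hfd
  have hu : Tendsto (fun k : ℕ => (1 / ((k : ℝ) + 1))) atTop (𝓝 0) :=
    tendsto_one_div_add_atTop_nhds_zero_nat
  have hu' : Tendsto (fun k : ℕ => (1 / ((k : ℝ) + 1))) atTop (𝓝[≠] 0) := by
    refine tendsto_nhdsWithin_iff.2 ⟨hu, Eventually.of_forall fun k => ?_⟩
    simp only [Set.mem_compl_iff, Set.mem_singleton_iff]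
    positivity
  refine lim_mem G hG (fun k => (k : ℝ) + 1) (fun k => L (f (1 / ((k : ℝ) + 1)))) (X + Y) ?_ ?_ ?_ t
  · have := hgd.continuousAt.tendsto.comp hu
    simp only [hf0, hL1] at this
    exact this
  · have h1 : ∀ᶠ y in 𝓝 (f 0), exp (L y) = y := by
      have := (strict_exp (A := A)).eventually_right_inverse
      rw [exp_zero] at this
      rwa [hf0]
    have h2 := (hfd.continuousAt.tendsto.comp hu).eventually h1
    filter_upwards [h2] with k hk
    have : expU (L (f (1 / ((k : ℝ) + 1)))) =
        expU ((1 / ((k : ℝ) + 1)) • X) * expU ((1 / ((k : ℝ) + 1)) • Y) := by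
      ext
      exact hk
    rw [this]
    exact G.mul_mem (hX _) (hY _)
  · have := (hasDerivAt_iff_tendsto_slope_zero.1 hgd).comp hu'
    refine this.congr fun k => ?_
    simp [hf0, hL1]

/-- The Lie algebra. -/
noncomputable def lie (G : Subgroup Aˣ) (hG : IsClosed (G : Set Aˣ)) : Submodule ℝ A where
  carrier := {X | ∀ t : ℝ, expU (t • X) ∈ G}
  add_mem' := fun {X Y} hX hY => add_mem_aux G hG X Y hX hY
  zero_mem' := fun t => by simp [expU_zero, G.one_mem]
  smul_mem' := fun c X hX t => by rw [smul_smul]; exact hX _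

theorem mem_lie {G : Subgroup Aˣ} {hG : IsClosed (G : Set Aˣ)} {X : A} :
    X ∈ lie G hG ↔ ∀ t : ℝ, expU (t • X) ∈ G := Iff.rfl

variable [FiniteDimensional ℝ A]

theorem compl_aux (G : Subgroup Aˣ) (hG : IsClosed (G : Set Aˣ)) (W : Submodule ℝ A)
    (hW : Disjoint (lie G hG) W) : ∀ᶠ w : W in 𝓝 0, expU (w : A) ∈ G → w = 0 := by
  by_contra hcon
  rw [Filter.not_eventually] at hcon
  obtain ⟨w, hw0, hw⟩ := Filter.exists_seq_forall_of_frequently hcon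
  push Not at hw
  have hs : ∀ k, ‖w k‖⁻¹ • w k ∈ Metric.sphere (0 : W) 1 := fun k => by
    have := norm_pos_iff.2 (hw k).2
    rw [mem_sphere_zero_iff_norm, norm_smul, norm_inv, norm_norm, inv_mul_cancel₀ this.ne']
  have : ProperSpace W := FiniteDimensional.proper ℝ W
  obtain ⟨Y, hY, φ, hφ, hlim⟩ := (isCompact_sphere (0 : W) 1).tendsto_subseq hs
  have hYl : (Y : A) ∈ lie G hG := by
    intro t
    refine lim_mem G hG (fun k => ‖w (φ k)‖⁻¹) (fun k => (w (φ k) : A)) Y ?_ ?_ ?_ t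
    · exact (continuous_subtype_val.tendsto (0 : W)).comp (hw0.comp hφ.tendsto_atTop)
    · exact Eventually.of_forall fun k => (hw _).1
    · exact (continuous_subtype_val.tendsto Y).comp hlim
  have : (Y : A) = 0 := Submodule.disjoint_def.1 hW _ hYl Y.2
  have hY0 : Y = 0 := Subtype.ext this
  rw [hY0] at hY
  simp at hY

theorem local_exp (G : Subgroup Aˣ) (hG : IsClosed (G : Set Aˣ)) :
    ∀ᶠ u : Aˣ in 𝓝 1, u ∈ G → ∃ X ∈ lie G hG, expU X = u := by
  obtain ⟨W, hW⟩ := (lie G hG).exists_isCompl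
  set V := lie G hG with hV
  let e : (V × W) ≃L[ℝ] A := (V.prodEquivOfIsCompl W hW).toContinuousLinearEquiv
  have hΦ : HasStrictFDerivAt (fun p : V × W => exp (p.1 : A) * exp (p.2 : A))
      (e : (V × W) →L[ℝ] A) 0 := by
    have h0 : HasStrictFDerivAt (exp : A → A) (1 : A →L[ℝ] A) 0 := hasStrictFDerivAt_exp_zero
    have h1 : HasStrictFDerivAt (fun p : V × W => exp (p.1 : A))
        (V.subtypeL.comp (ContinuousLinearMap.fst ℝ V W)) 0 :=
      HasStrictFDerivAt.comp (g := (exp : A → A)) (g' := (1 : A →L[ℝ] A)) (0 : V × W)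
        (by simpa using h0) (V.subtypeL.comp (ContinuousLinearMap.fst ℝ V W)).hasStrictFDerivAt
    have h2 : HasStrictFDerivAt (fun p : V × W => exp (p.2 : A))
        (W.subtypeL.comp (ContinuousLinearMap.snd ℝ V W)) 0 :=
      HasStrictFDerivAt.comp (g := (exp : A → A)) (g' := (1 : A →L[ℝ] A)) (0 : V × W)
        (by simpa using h0) (W.subtypeL.comp (ContinuousLinearMap.snd ℝ V W)).hasStrictFDerivAt
    refine (h1.mul' h2).congr_fderiv ?_
    ext p <;> simp [e]
  set L := hΦ.localInverse with hL
  have hΦ0 : exp (((0 : V × W).1 : V) : A) * exp (((0 : V × W).2 : W) : A) = 1 := by simp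
  have ht : Tendsto L (𝓝 1) (𝓝 0) := by
    have := hΦ.localInverse_tendsto
    rwa [hΦ0] at this
  have hr : ∀ᶠ y in 𝓝 (1 : A), exp ((L y).1 : A) * exp ((L y).2 : A) = y := by
    have := hΦ.eventually_right_inverse
    rwa [hΦ0] at this
  have hv : Tendsto (fun u : Aˣ => (u : A)) (𝓝 1) (𝓝 1) := Units.continuous_val.tendsto 1
  have hc : Tendsto (fun u : Aˣ => (L u).2) (𝓝 1) (𝓝 0) :=
    (continuous_snd.tendsto (0 : V × W)).comp (ht.comp hv)
  filter_upwards [hc.eventually (compl_aux G hG W hW.disjoint), hv.eventually hr] with u h1 h2 hu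
  have hX : ((L u).1 : A) ∈ lie G hG := (L u).1.2
  have h3 : expU ((L u).1 : A) * expU ((L u).2 : A) = u := by ext; exact h2
  have h4 : expU ((L u).1 : A) ∈ G := by simpa using hX 1
  have h5 : expU ((L u).2 : A) ∈ G := by
    rw [← h3] at hu
    exact (G.mul_mem_cancel_left h4).1 hu
  refine ⟨_, hX, ?_⟩
  rw [h1 h5] at h3
  simpa [expU_zero] using h3

/-- The subgroup of products of exponentials. -/
noncomputable def prodSub (G : Subgroup Aˣ) (hG : IsClosed (G : Set Aˣ)) : Subgroup Aˣ where
  carrier := {u | ∃ l : List A, (∀ X ∈ l, X ∈ lie G hG) ∧ u = (l.map expU).prod}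
  one_mem' := ⟨[], by simp, by simp⟩
  mul_mem' := by
    rintro _ _ ⟨l, hl, rfl⟩ ⟨m, hm, rfl⟩
    refine ⟨l ++ m, ?_, by simp⟩
    intro X hX
    rcases List.mem_append.1 hX with h | h
    exacts [hl X h, hm X h]
  inv_mem' := by
    rintro _ ⟨l, hl, rfl⟩
    refine ⟨(l.map fun x => -x).reverse, ?_, ?_⟩
    · intro X hX
      simp only [List.mem_reverse, List.mem_map] at hX
      obtain ⟨Y, hY, rfl⟩ := hX
      exact neg_mem (hl Y hY)
    · rw [List.prod_inv_reverse, List.map_reverse, List.map_map, List.map_map]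
      congr 3
      funext x
      simp [expU_neg]

theorem main (G : Subgroup Aˣ) (hG : IsClosed (G : Set Aˣ)) (hc : IsConnected (G : Set Aˣ))
    (g : Aˣ) (hg : g ∈ G) :
    ∃ (M : ℕ) (X : Fin M → A),
      (∀ i, ∀ t : ℝ, ∃ h ∈ G, (h : A) = exp (t • X i)) ∧
      (g : A) = ((List.ofFn X).map exp).prod := by
  have hopen : IsOpen (((prodSub G hG).subgroupOf G : Subgroup G) : Set G) := by
    apply Subgroup.isOpen_of_mem_nhds _ (g := 1)
    have h1 : Tendsto (fun u : G => (u : Aˣ)) (𝓝 1) (𝓝 1) := continuous_subtype_val.tendsto (1 : G)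
    filter_upwards [h1.eventually (local_exp G hG)] with u hu
    obtain ⟨X, hX, hXu⟩ := hu u.2
    exact ⟨[X], by simpa using hX, by simp [hXu]⟩
  have : ConnectedSpace G := isConnected_iff_connectedSpace.1 hc
  have huniv := IsClopen.eq_univ
    ⟨Subgroup.isClosed_of_isOpen _ hopen, hopen⟩ ⟨1, one_mem _⟩
  have hmem : (⟨g, hg⟩ : G) ∈ (((prodSub G hG).subgroupOf G : Subgroup G) : Set G) := by
    rw [huniv]; trivial
  obtain ⟨l, hl, hgl⟩ : ∃ l : List A, (∀ X ∈ l, X ∈ lie G hG) ∧ g = (l.map expU).prod := hmem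
  refine ⟨l.length, l.get, fun i t => ⟨_, hl _ (l.get_mem i) t, rfl⟩, ?_⟩
  rw [List.ofFn_get, hgl, ← Units.coeHom_apply, map_list_prod, List.map_map]
  rfl

end

end CartanAux



/-- Every element of a closed connected subgroup `G` of `GL(n, ℝ)` (a connected matrix Lie
group) can be written as a finite product of exponentials of elements of its Lie algebra
`𝔤 = { X | exp(t·X) ∈ G for all t ∈ ℝ }`. -/
theorem exists_prod_exp_of_mem_connected_closed_subgroup {n : ℕ}
    (G : Subgroup (GL (Fin n) ℝ))
    (hclosed : IsClosed (G : Set (GL (Fin n) ℝ)))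
    (hconn : IsConnected (G : Set (GL (Fin n) ℝ)))
    (g : GL (Fin n) ℝ) (hg : g ∈ G) :
    ∃ (M : ℕ) (X : Fin M → Matrix (Fin n) (Fin n) ℝ),
      (∀ i, ∀ t : ℝ, ∃ h ∈ G,
          (h : Matrix (Fin n) (Fin n) ℝ) = NormedSpace.exp (t • X i)) ∧
      (g : Matrix (Fin n) (Fin n) ℝ) =
        ((List.ofFn X).map NormedSpace.exp).prod := by
  exact @CartanAux.main (Matrix (Fin n) (Fin n) ℝ) Matrix.linftyOpNormedRing
    Matrix.linftyOpNormedAlgebra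
    (inferInstanceAs (CompleteSpace (Fin n → Fin n → ℝ)))
    (inferInstanceAs (FiniteDimensional ℝ (Fin n → Fin n → ℝ))) G hclosed hconn g hg
end
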